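/- Suppose C(T ⊗ T') = C(T) + C(T') for channels T, T' with Stinespring dilations giving subspaces K, K'. If ρ is a state on K attaining C(T) = S(Tr₁ρ) − E_f(ρ) and ρ' is a state on K' attaining C(T') = S(Tr₁ρ') − E_f(ρ'), then E_f(ρ⊗ρ') = E_f(ρ) + E_f(ρ'). -/

import Mathlib

open scoped Matrix Kronecker ComplexOrder
open Matrix

noncomputable section

/-- Square complex matrices indexed by `d`. -/
abbrev Mat (d : Type) [Fintype d] : Type := Matrix d d ℂ

/-- A density operator: positive semidefinite with unit trace. -/
def IsState {d : Type} [Fintype d] [DecidableEq d] (ρ : Mat d) : Prop :=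
  ρ.PosSemidef ∧ ρ.trace = 1

/-- Von Neumann entropy `S(ρ) = -Tr ρ log ρ`, via eigenvalues (junk value 0
if `ρ` is not Hermitian). -/
def entropy {d : Type} [Fintype d] [DecidableEq d] (ρ : Mat d) : ℝ :=
  if h : ρ.IsHermitian then ∑ i, Real.negMulLog (h.eigenvalues i) else 0

/-- Partial trace over the first tensor factor. -/
def ptrace₁ {d₁ d₂ : Type} [Fintype d₁] [Fintype d₂] (ρ : Mat (d₁ × d₂)) : Mat d₂ :=
  Matrix.of fun j j' => ∑ i, ρ (i, j) (i, j')

/-- Partial trace over the second tensor factor. -/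
def ptrace₂ {d₁ d₂ : Type} [Fintype d₁] [Fintype d₂] (ρ : Mat (d₁ × d₂)) : Mat d₁ :=
  Matrix.of fun i i' => ∑ j, ρ (i, j) (i', j)

/-- The pure state (rank-one projector) `|v⟩⟨v|`. -/
def pureState {d : Type} [Fintype d] (v : d → ℂ) : Mat d :=
  Matrix.vecMulVec v (star v)

/-- `v` is a unit vector. -/
def UnitVec {d : Type} [Fintype d] (v : d → ℂ) : Prop :=
  ∑ i, ‖v i‖ ^ 2 = 1

/-- Entropy of entanglement of a pure bipartite state. -/
def pureEnt {d₁ d₂ : Type} [Fintype d₁] [Fintype d₂] [DecidableEq d₁]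
    (v : d₁ × d₂ → ℂ) : ℝ :=
  entropy (ptrace₂ (pureState v))

/-- Average entanglements of pure-state decompositions of `ρ`. -/
def efVals {d₁ d₂ : Type} [Fintype d₁] [Fintype d₂] [DecidableEq d₁]
    (ρ : Mat (d₁ × d₂)) : Set ℝ :=
  {x | ∃ (m : ℕ) (p : Fin m → ℝ) (v : Fin m → (d₁ × d₂ → ℂ)),
    (∀ i, 0 ≤ p i) ∧ (∀ i, UnitVec (v i)) ∧
    ρ = ∑ i, (p i : ℂ) • pureState (v i) ∧
    x = ∑ i, p i * pureEnt (v i)}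

/-- Entanglement of formation. -/
def Ef {d₁ d₂ : Type} [Fintype d₁] [Fintype d₂] [DecidableEq d₁]
    (ρ : Mat (d₁ × d₂)) : ℝ :=
  sInf (efVals ρ)

/-- Holevo quantities of pure-state input ensembles for the channel `T`. -/
def capVals {d d₂ : Type} [Fintype d] [Fintype d₂] [DecidableEq d₂]
    (T : Mat d → Mat d₂) : Set ℝ :=
  {x | ∃ (m : ℕ) (p : Fin m → ℝ) (v : Fin m → (d → ℂ)),
    (∀ i, 0 ≤ p i) ∧ (∑ i, p i = 1) ∧ (∀ i, UnitVec (v i)) ∧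
    x = entropy (∑ i, (p i : ℂ) • T (pureState (v i)))
        - ∑ i, p i * entropy (T (pureState (v i)))}

/-- Holevo capacity of the channel `T`. -/
def holevoCap {d d₂ : Type} [Fintype d] [Fintype d₂] [DecidableEq d₂]
    (T : Mat d → Mat d₂) : ℝ :=
  sSup (capVals T)


/-- Tensor product of two bipartite states, regrouped across the
`(H₁⊗H₁'):(H₂⊗H₂')` bipartition. -/
def pairProd {d₁ d₂ d₁' d₂' : Type} [Fintype d₁] [Fintype d₂] [Fintype d₁'] [Fintype d₂']
    (ρ : Mat (d₁ × d₂)) (ρ' : Mat (d₁' × d₂')) : Mat ((d₁ × d₁') × (d₂ × d₂')) :=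
  Matrix.of fun a b =>
    ρ (a.1.1, a.2.1) (b.1.1, b.2.1) * ρ' (a.1.2, a.2.2) (b.1.2, b.2.2)

/-- Marginal of a state on the composite of two bipartite systems on the
first (unprimed) bipartite system. -/
def marg₁ {d₁ d₂ d₁' d₂' : Type} [Fintype d₁] [Fintype d₂] [Fintype d₁'] [Fintype d₂']
    (ω : Mat ((d₁ × d₁') × (d₂ × d₂'))) : Mat (d₁ × d₂) :=
  Matrix.of fun a b => ∑ k : d₁', ∑ l : d₂', ω ((a.1, k), (a.2, l)) ((b.1, k), (b.2, l))

/-- Marginal of a state on the composite of two bipartite systems on the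
second (primed) bipartite system. -/
def marg₂ {d₁ d₂ d₁' d₂' : Type} [Fintype d₁] [Fintype d₂] [Fintype d₁'] [Fintype d₂']
    (ω : Mat ((d₁ × d₁') × (d₂ × d₂'))) : Mat (d₁' × d₂') :=
  Matrix.of fun a b => ∑ k : d₁, ∑ l : d₂, ω ((k, a.1), (l, a.2)) ((k, b.1), (l, b.2))

theorem entropy_eq_roots {d : Type} [Fintype d] [DecidableEq d] {A : Mat d}
    (hA : A.IsHermitian) :
    entropy A = (A.charpoly.roots.map fun z : ℂ => Real.negMulLog z.re).sum := by
  rw [entropy, dif_pos hA, hA.roots_charpoly_eq_eigenvalues, Multiset.map_map]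
  simp [Function.comp_def]

/-- The entropy only sees the diagonal entries of a unitary diagonalization. -/
theorem entropy_unitary_conj_diagonal {d : Type} [Fintype d] [DecidableEq d]
    {V : Mat d} (hV : Vᴴ * V = 1) (l : d → ℝ) :
    entropy (V * diagonal (fun i => (l i : ℂ)) * Vᴴ) = ∑ i, Real.negMulLog (l i) := by
  have hD : (diagonal fun i => (l i : ℂ)).IsHermitian := by
    rw [Matrix.IsHermitian, diagonal_conjTranspose]
    congr 1
    ext i
    simp
  rw [entropy_eq_roots (isHermitian_mul_mul_conjTranspose V hD), charpoly_mul_comm,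
    ← mul_assoc, hV, one_mul, charpoly_diagonal, Polynomial.roots_prod]
  · simp
  · simp [Finset.prod_ne_zero_iff, Polynomial.X_sub_C_ne_zero]

theorem exists_unitary_diagonalization {d : Type} [Fintype d] [DecidableEq d] {A : Mat d}
    (hA : A.IsHermitian) :
    ∃ V : Mat d, Vᴴ * V = 1 ∧
      A = V * diagonal (fun i => (hA.eigenvalues i : ℂ)) * Vᴴ := by
  refine ⟨hA.eigenvectorUnitary, ?_, ?_⟩
  · exact Unitary.coe_star_mul_self hA.eigenvectorUnitary
  · conv_lhs => rw [hA.spectral_theorem, Unitary.conjStarAlgAut_apply]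
    rfl

theorem sum_eigenvalues_eq_one {d : Type} [Fintype d] [DecidableEq d] {A : Mat d}
    (hA : A.IsHermitian) (h1 : A.trace = 1) : ∑ i, hA.eigenvalues i = 1 := by
  have h := congrArg Complex.re (hA.trace_eq_sum_eigenvalues.symm.trans h1)
  simpa using h

/-- Entropy of a Kronecker product of Hermitian matrices. -/
theorem entropy_kronecker {d d' : Type} [Fintype d] [Fintype d'] [DecidableEq d]
    [DecidableEq d'] {A : Mat d} {B : Mat d'} (hA : A.IsHermitian) (hB : B.IsHermitian)
    (hA1 : A.trace = 1) (hB1 : B.trace = 1) :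
    entropy (A ⊗ₖ B) = entropy A + entropy B := by
  obtain ⟨V, hV, hAV⟩ := exists_unitary_diagonalization hA
  obtain ⟨V', hV', hBV⟩ := exists_unitary_diagonalization hB
  have hAB : A ⊗ₖ B = (V ⊗ₖ V') * diagonal (fun i : d × d' =>
      ((hA.eigenvalues i.1 * hB.eigenvalues i.2 : ℝ) : ℂ)) * (V ⊗ₖ V')ᴴ := by
    conv_lhs => rw [hAV, hBV, mul_kronecker_mul, mul_kronecker_mul,
      diagonal_kronecker_diagonal, ← conjTranspose_kronecker]
    simp
  have hVV : (V ⊗ₖ V')ᴴ * (V ⊗ₖ V') = 1 := by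
    rw [conjTranspose_kronecker, ← mul_kronecker_mul, hV, hV', one_kronecker_one]
  have hsA := sum_eigenvalues_eq_one hA hA1
  have hsB := sum_eigenvalues_eq_one hB hB1
  rw [hAB, entropy_unitary_conj_diagonal hVV, entropy, entropy, dif_pos hA, dif_pos hB,
    Fintype.sum_prod_type]
  simp only [Real.negMulLog_mul, Finset.sum_add_distrib, ← Finset.sum_mul, ← Finset.mul_sum,
    hsA, hsB, one_mul]

theorem IsState.entropy_nonneg {d : Type} [Fintype d] [DecidableEq d] {ρ : Mat d}
    (h : IsState ρ) : 0 ≤ entropy ρ := by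
  have hs := sum_eigenvalues_eq_one h.1.1 h.2
  rw [entropy, dif_pos h.1.1]
  refine Finset.sum_nonneg fun i _ => Real.negMulLog_nonneg (h.1.eigenvalues_nonneg i) ?_
  rw [← hs]
  exact Finset.single_le_sum (fun j _ => h.1.eigenvalues_nonneg j) (Finset.mem_univ i)

theorem entropy_le_card {d : Type} [Fintype d] [DecidableEq d] {ρ : Mat d}
    (h : ρ.PosSemidef) : entropy ρ ≤ Fintype.card d := by
  rw [entropy, dif_pos h.1]
  calc ∑ i, Real.negMulLog (h.1.eigenvalues i) ≤ ∑ _i : d, (1 : ℝ) := by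
        refine Finset.sum_le_sum fun i _ => ?_
        have h0 := h.eigenvalues_nonneg i
        linarith [Real.negMulLog_le_one_sub_self h0]
    _ = Fintype.card d := by simp

/-- `A Aᴴ` and `Aᴴ A` have the same entropy. -/
theorem entropy_mul_conjTranspose_comm {m n : Type} [Fintype m] [Fintype n] [DecidableEq m]
    [DecidableEq n] (A : Matrix m n ℂ) : entropy (A * Aᴴ) = entropy (Aᴴ * A) := by
  rw [entropy_eq_roots (isHermitian_mul_conjTranspose_self A),
    entropy_eq_roots (isHermitian_conjTranspose_mul_self A)]
  have h := congrArg Polynomial.roots (charpoly_mul_comm' A Aᴴ)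
  rw [Polynomial.roots_mul (mul_ne_zero (pow_ne_zero _ Polynomial.X_ne_zero)
      (charpoly_monic _).ne_zero),
    Polynomial.roots_mul (mul_ne_zero (pow_ne_zero _ Polynomial.X_ne_zero)
      (charpoly_monic _).ne_zero), Polynomial.roots_X_pow, Polynomial.roots_X_pow] at h
  have h2 := congrArg (fun s => (Multiset.map (fun z : ℂ => Real.negMulLog z.re) s).sum) h
  simpa [Multiset.map_nsmul, Multiset.sum_nsmul] using h2

theorem entropy_transpose {d : Type} [Fintype d] [DecidableEq d] {A : Mat d}
    (hA : A.IsHermitian) : entropy Aᵀ = entropy A := by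
  rw [entropy_eq_roots hA, entropy_eq_roots hA.transpose, charpoly_transpose]

theorem ptrace₂_pureState {d₁ d₂ : Type} [Fintype d₁] [Fintype d₂] (v : d₁ × d₂ → ℂ) :
    ptrace₂ (pureState v) = (of fun i j => v (i, j)) * (of fun i j => v (i, j))ᴴ := by
  ext i i'
  simp [ptrace₂, pureState, vecMulVec_apply, mul_apply]

theorem ptrace₁_pureState {d₁ d₂ : Type} [Fintype d₁] [Fintype d₂] (v : d₁ × d₂ → ℂ) :
    ptrace₁ (pureState v) = ((of fun i j => v (i, j))ᴴ * (of fun i j => v (i, j)))ᵀ := by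
  ext j j'
  simp [ptrace₁, pureState, vecMulVec_apply, mul_apply, mul_comm]

/-- The two reduced states of a pure bipartite state have the same entropy. -/
theorem entropy_ptrace₁_pureState {d₁ d₂ : Type} [Fintype d₁] [Fintype d₂] [DecidableEq d₁]
    [DecidableEq d₂] (v : d₁ × d₂ → ℂ) : entropy (ptrace₁ (pureState v)) = pureEnt v := by
  rw [pureEnt, ptrace₁_pureState, ptrace₂_pureState,
    entropy_transpose (isHermitian_conjTranspose_mul_self _), entropy_mul_conjTranspose_comm]

theorem trace_ptrace₁ {d₁ d₂ : Type} [Fintype d₁] [Fintype d₂] (ρ : Mat (d₁ × d₂)) :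
    (ptrace₁ ρ).trace = ρ.trace := by
  simp only [trace, ptrace₁, diag_apply, of_apply, Fintype.sum_prod_type]
  exact Finset.sum_comm

theorem trace_ptrace₂ {d₁ d₂ : Type} [Fintype d₁] [Fintype d₂] (ρ : Mat (d₁ × d₂)) :
    (ptrace₂ ρ).trace = ρ.trace := by
  simp only [trace, ptrace₂, diag_apply, of_apply, Fintype.sum_prod_type]

theorem posSemidef_ptrace₁ {d₁ d₂ : Type} [Fintype d₁] [Fintype d₂] {ρ : Mat (d₁ × d₂)}
    (h : ρ.PosSemidef) : (ptrace₁ ρ).PosSemidef := by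
  have : ptrace₁ ρ = ∑ i, ρ.submatrix (fun j => (i, j)) (fun j => (i, j)) := by
    ext j j'
    simp [ptrace₁, Matrix.sum_apply]
  rw [this]
  exact posSemidef_sum _ fun i _ => h.submatrix _

theorem posSemidef_pureState {d : Type} [Fintype d] (v : d → ℂ) :
    (pureState v).PosSemidef := posSemidef_vecMulVec_self_star v

theorem trace_pureState {d : Type} [Fintype d] (v : d → ℂ) :
    (pureState v).trace = ((∑ i, ‖v i‖ ^ 2 : ℝ) : ℂ) := by
  simp [pureState, trace, vecMulVec_apply, Complex.mul_conj, Complex.normSq_eq_norm_sq]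

theorem UnitVec.isState {d : Type} [Fintype d] [DecidableEq d] {v : d → ℂ}
    (h : UnitVec v) : IsState (pureState v) :=
  ⟨posSemidef_pureState v, by rw [trace_pureState, h, Complex.ofReal_one]⟩

theorem UnitVec.pureEnt_nonneg {d₁ d₂ : Type} [Fintype d₁] [Fintype d₂] [DecidableEq d₁]
    [DecidableEq d₂] {v : d₁ × d₂ → ℂ} (h : UnitVec v) : 0 ≤ pureEnt v := by
  refine IsState.entropy_nonneg ⟨?_, ?_⟩
  · rw [ptrace₂_pureState]
    exact posSemidef_self_mul_conjTranspose _
  · rw [trace_ptrace₂]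
    exact h.isState.2

theorem sum_eq_trace_of_pureState_decomposition {d ι : Type} [Fintype d] [Fintype ι]
    {p : ι → ℝ} {v : ι → d → ℂ} (hv : ∀ i, UnitVec (v i)) :
    (∑ i, (p i : ℂ) • pureState (v i)).trace = ((∑ i, p i : ℝ) : ℂ) := by
  classical
  rw [trace_sum]
  simp [trace_smul, (hv _).isState.2]

/-- Membership in `efVals` from an ensemble with arbitrary finite index type. -/
theorem mem_efVals {d₁ d₂ ι : Type} [Fintype d₁] [Fintype d₂] [DecidableEq d₁] [Fintype ι]
    (p : ι → ℝ) (v : ι → d₁ × d₂ → ℂ) (hp : ∀ i, 0 ≤ p i) (hv : ∀ i, UnitVec (v i)) :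
    ∑ i, p i * pureEnt (v i) ∈ efVals (∑ i, (p i : ℂ) • pureState (v i)) := by
  let e := (Fintype.equivFin ι).symm
  exact ⟨Fintype.card ι, p ∘ e, v ∘ e, fun i => hp _, fun i => hv _,
    (Equiv.sum_comp e fun i => (p i : ℂ) • pureState (v i)).symm,
    (Equiv.sum_comp e fun i => p i * pureEnt (v i)).symm⟩

theorem efVals_nonempty {d₁ d₂ : Type} [Fintype d₁] [Fintype d₂] [DecidableEq d₁]
    [DecidableEq d₂] {ρ : Mat (d₁ × d₂)} (h : ρ.PosSemidef) : (efVals ρ).Nonempty := by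
  obtain ⟨V, hV, hρ⟩ := exists_unitary_diagonalization h.1
  have hdec : ρ = ∑ k, (h.1.eigenvalues k : ℂ) • pureState fun i => V i k := by
    conv_lhs => rw [hρ]
    ext i j
    simp [mul_apply, Matrix.sum_apply, pureState, vecMulVec_apply, diagonal_apply]
    exact Finset.sum_congr rfl fun k _ => by ring
  have hu : ∀ k, UnitVec fun i => V i k := by
    intro k
    have := congrFun (congrFun hV k) k
    simp only [mul_apply, conjTranspose_apply, one_apply_eq, RCLike.star_def,
      Complex.conj_mul'] at this
    exact_mod_cast this
  have := mem_efVals _ _ h.eigenvalues_nonneg hu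
  rw [← hdec] at this
  exact ⟨_, this⟩

theorem efVals_bddBelow {d₁ d₂ : Type} [Fintype d₁] [Fintype d₂] [DecidableEq d₁]
    [DecidableEq d₂] (ρ : Mat (d₁ × d₂)) : BddBelow (efVals ρ) := by
  refine ⟨0, ?_⟩
  rintro x ⟨m, p, v, hp, hv, -, rfl⟩
  exact Finset.sum_nonneg fun i _ => mul_nonneg (hp i) (hv i).pureEnt_nonneg

theorem ptrace₁_pairProd {d₁ d₂ d₁' d₂' : Type} [Fintype d₁] [Fintype d₂] [Fintype d₁']
    [Fintype d₂'] (ρ : Mat (d₁ × d₂)) (ρ' : Mat (d₁' × d₂')) :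
    ptrace₁ (pairProd ρ ρ') = ptrace₁ ρ ⊗ₖ ptrace₁ ρ' := by
  ext a b
  simp [ptrace₁, pairProd, kroneckerMap_apply, Fintype.sum_prod_type, Finset.sum_mul_sum]

theorem ptrace₂_pairProd {d₁ d₂ d₁' d₂' : Type} [Fintype d₁] [Fintype d₂] [Fintype d₁']
    [Fintype d₂'] (ρ : Mat (d₁ × d₂)) (ρ' : Mat (d₁' × d₂')) :
    ptrace₂ (pairProd ρ ρ') = ptrace₂ ρ ⊗ₖ ptrace₂ ρ' := by
  ext a b
  simp [ptrace₂, pairProd, kroneckerMap_apply, Fintype.sum_prod_type, Finset.sum_mul_sum]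

/-- Tensor product of bipartite vectors, regrouped as in `pairProd`. -/
def pairVec {d₁ d₂ d₁' d₂' : Type} (v : d₁ × d₂ → ℂ) (w : d₁' × d₂' → ℂ) :
    (d₁ × d₁') × (d₂ × d₂') → ℂ :=
  fun a => v (a.1.1, a.2.1) * w (a.1.2, a.2.2)

theorem pureState_pairVec {d₁ d₂ d₁' d₂' : Type} [Fintype d₁] [Fintype d₂] [Fintype d₁']
    [Fintype d₂'] (v : d₁ × d₂ → ℂ) (w : d₁' × d₂' → ℂ) :
    pureState (pairVec v w) = pairProd (pureState v) (pureState w) := by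
  ext a b
  simp only [pureState, pairVec, pairProd, vecMulVec_apply, of_apply, Pi.star_apply, star_mul']
  ring

theorem UnitVec.pairVec {d₁ d₂ d₁' d₂' : Type} [Fintype d₁] [Fintype d₂] [Fintype d₁']
    [Fintype d₂'] {v : d₁ × d₂ → ℂ} {w : d₁' × d₂' → ℂ} (hv : UnitVec v) (hw : UnitVec w) :
    UnitVec (pairVec v w) := by
  unfold UnitVec at *
  calc ∑ a, ‖_root_.pairVec v w a‖ ^ 2
      = ∑ a : (d₁ × d₂) × (d₁' × d₂'), ‖v a.1‖ ^ 2 * ‖w a.2‖ ^ 2 := by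
        rw [← Equiv.sum_comp (Equiv.prodProdProdComm d₁ d₂ d₁' d₂')]
        simp [_root_.pairVec, mul_pow]
    _ = 1 := by
        simp only [Fintype.sum_prod_type (α₁ := d₁ × d₂)]
        rw [← Finset.sum_mul_sum, hv, hw, one_mul]

theorem pureEnt_pairVec {d₁ d₂ d₁' d₂' : Type} [Fintype d₁] [Fintype d₂] [Fintype d₁']
    [Fintype d₂'] [DecidableEq d₁] [DecidableEq d₂] [DecidableEq d₁'] [DecidableEq d₂']
    {v : d₁ × d₂ → ℂ} {w : d₁' × d₂' → ℂ} (hv : UnitVec v) (hw : UnitVec w) :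
    pureEnt (pairVec v w) = pureEnt v + pureEnt w := by
  rw [pureEnt, pureState_pairVec, ptrace₂_pairProd, entropy_kronecker, pureEnt, pureEnt]
  · rw [ptrace₂_pureState]; exact isHermitian_mul_conjTranspose_self _
  · rw [ptrace₂_pureState]; exact isHermitian_mul_conjTranspose_self _
  · rw [trace_ptrace₂, hv.isState.2]
  · rw [trace_ptrace₂, hw.isState.2]

theorem pairProd_sum_sum {d₁ d₂ d₁' d₂' ι κ : Type} [Fintype d₁] [Fintype d₂] [Fintype d₁']
    [Fintype d₂'] [Fintype ι] [Fintype κ] (p : ι → ℝ) (q : κ → ℝ) (A : ι → Mat (d₁ × d₂))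
    (B : κ → Mat (d₁' × d₂')) :
    pairProd (∑ i, (p i : ℂ) • A i) (∑ k, (q k : ℂ) • B k)
      = ∑ x : ι × κ, ((p x.1 * q x.2 : ℝ) : ℂ) • pairProd (A x.1) (B x.2) := by
  ext a b
  simp only [pairProd, of_apply, Matrix.sum_apply, Matrix.smul_apply, smul_eq_mul,
    Finset.sum_mul_sum, Fintype.sum_prod_type, Complex.ofReal_mul]
  exact Finset.sum_congr rfl fun i _ => Finset.sum_congr rfl fun k _ => by ring

/-- Subadditivity of the entanglement of formation on product states. -/
theorem Ef_pairProd_le {d₁ d₂ d₁' d₂' : Type} [Fintype d₁] [Fintype d₂] [Fintype d₁']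
    [Fintype d₂'] [DecidableEq d₁] [DecidableEq d₂] [DecidableEq d₁'] [DecidableEq d₂']
    {ρ : Mat (d₁ × d₂)} {ρ' : Mat (d₁' × d₂')} (h : IsState ρ) (h' : IsState ρ') :
    Ef (pairProd ρ ρ') ≤ Ef ρ + Ef ρ' := by
  have key : ∀ x ∈ efVals ρ, ∀ y ∈ efVals ρ', Ef (pairProd ρ ρ') ≤ x + y := by
    rintro x ⟨m, p, v, hp, hv, hρ, rfl⟩ y ⟨n, q, w, hq, hw, hρ', rfl⟩
    have hp1 : ∑ i, p i = 1 := by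
      have := sum_eq_trace_of_pureState_decomposition (p := p) hv
      rw [← hρ, h.2] at this
      exact_mod_cast this.symm
    have hq1 : ∑ i, q i = 1 := by
      have := sum_eq_trace_of_pureState_decomposition (p := q) hw
      rw [← hρ', h'.2] at this
      exact_mod_cast this.symm
    have hmem := mem_efVals (fun x : Fin m × Fin n => p x.1 * q x.2)
      (fun x => pairVec (v x.1) (w x.2)) (fun x => mul_nonneg (hp _) (hq _))
      (fun x => (hv _).pairVec (hw _))
    simp only [pureState_pairVec] at hmem
    rw [← pairProd_sum_sum p q (fun i => pureState (v i)) (fun j => pureState (w j)),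
      ← hρ, ← hρ'] at hmem
    refine (csInf_le (efVals_bddBelow _) hmem).trans_eq ?_
    calc ∑ x : Fin m × Fin n, p x.1 * q x.2 * pureEnt (pairVec (v x.1) (w x.2))
        = ∑ i, ∑ j, (p i * pureEnt (v i) * q j + p i * (q j * pureEnt (w j))) := by
          rw [Fintype.sum_prod_type]
          refine Finset.sum_congr rfl fun i _ => Finset.sum_congr rfl fun j _ => ?_
          rw [pureEnt_pairVec (hv i) (hw j)]
          ring
      _ = _ := by
          simp only [Finset.sum_add_distrib]
          rw [← Finset.sum_mul_sum, ← Finset.sum_mul_sum, hp1, hq1, mul_one, one_mul]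
  have h1 : ∀ y ∈ efVals ρ', Ef (pairProd ρ ρ') - y ≤ Ef ρ := fun y hy =>
    le_csInf (efVals_nonempty h.1) fun x hx => by linarith [key x hx y hy]
  have h2 : Ef (pairProd ρ ρ') - Ef ρ ≤ Ef ρ' :=
    le_csInf (efVals_nonempty h'.1) fun y hy => by linarith [h1 y hy]
  linarith

theorem pureState_mulVec {d e : Type} [Fintype d] [Fintype e] (W : Matrix e d ℂ)
    (u : d → ℂ) : W * pureState u * Wᴴ = pureState (W *ᵥ u) := by
  rw [pureState, mul_vecMulVec, vecMulVec_mul, pureState, star_mulVec]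

/-- If a mixture of pure states is supported on the range of an isometry, so is every vector
occurring with nonzero weight. -/
theorem mulVec_conjTranspose_mulVec_of_decomposition {d e ι : Type} [Fintype d] [Fintype e]
    [DecidableEq d] [Fintype ι] {W : Matrix e d ℂ} (hW : Wᴴ * W = 1) (τ : Mat d)
    {p : ι → ℝ} {v : ι → e → ℂ} (hp : ∀ i, 0 ≤ p i)
    (h : W * τ * Wᴴ = ∑ i, (p i : ℂ) • pureState (v i)) {i : ι} (hi : p i ≠ 0) :
    W *ᵥ (Wᴴ *ᵥ v i) = v i := by
  classical
  set Q : Mat e := 1 - W * Wᴴ with hQ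
  have hQW : Q * W = 0 := by
    rw [hQ, Matrix.sub_mul, Matrix.one_mul, Matrix.mul_assoc, hW, Matrix.mul_one, sub_self]
  have h0 : ∑ i, (p i : ℂ) • pureState (Q *ᵥ v i) = 0 := by
    calc ∑ i, (p i : ℂ) • pureState (Q *ᵥ v i)
        = Q * (∑ i, (p i : ℂ) • pureState (v i)) * Qᴴ := by
          simp only [Finset.mul_sum, Finset.sum_mul, mul_smul_comm, smul_mul_assoc, pureState_mulVec]
      _ = 0 := by rw [← h, ← Matrix.mul_assoc, ← Matrix.mul_assoc, hQW]; simp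
  have h1 : ∑ i, p i * ∑ a, ‖(Q *ᵥ v i) a‖ ^ 2 = 0 := by
    have := congrArg trace h0
    simp only [trace_sum, trace_smul, trace_pureState, trace_zero, smul_eq_mul] at this
    exact_mod_cast this
  have h2 := (Finset.sum_eq_zero_iff_of_nonneg fun j _ =>
    mul_nonneg (hp j) (Finset.sum_nonneg fun a _ => sq_nonneg _)).1 h1 i (Finset.mem_univ i)
  have h3 := (Finset.sum_eq_zero_iff_of_nonneg fun a _ => sq_nonneg _).1
    ((mul_eq_zero.1 h2).resolve_left hi)
  have h4 : Q *ᵥ v i = 0 := by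
    ext a
    simpa using h3 a (Finset.mem_univ a)
  rw [hQ, sub_mulVec, one_mulVec, sub_eq_zero, ← mulVec_mulVec] at h4
  exact h4.symm

theorem trace_isometry_conj {d e : Type} [Fintype d] [Fintype e] [DecidableEq d]
    {W : Matrix e d ℂ} (hW : Wᴴ * W = 1) (σ : Mat d) : (W * σ * Wᴴ).trace = σ.trace := by
  rw [trace_mul_comm, ← Matrix.mul_assoc, hW, one_mul]

theorem unitVec_iff_trace_pureState {d : Type} [Fintype d] {v : d → ℂ} :
    UnitVec v ↔ (pureState v).trace = 1 := by
  rw [trace_pureState, UnitVec]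
  norm_cast

theorem IsState.isometry_conj {d e : Type} [Fintype d] [Fintype e] [DecidableEq d]
    [DecidableEq e] {W : Matrix e d ℂ} (hW : Wᴴ * W = 1) {σ : Mat d} (h : IsState σ) :
    IsState (W * σ * Wᴴ) :=
  ⟨h.1.mul_mul_conjTranspose_same W, by rw [trace_isometry_conj hW, h.2]⟩

theorem ptrace₁_sum_smul {d₁ d₂ ι : Type} [Fintype d₁] [Fintype d₂] [Fintype ι]
    (c : ι → ℂ) (A : ι → Mat (d₁ × d₂)) :
    ptrace₁ (∑ i, c i • A i) = ∑ i, c i • ptrace₁ (A i) := by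
  ext a b
  simp only [ptrace₁, of_apply, Matrix.sum_apply, Matrix.smul_apply, smul_eq_mul,
    Finset.mul_sum]
  exact Finset.sum_comm

/-- The Holevo quantities of a channel in Stinespring form are bounded above. -/
theorem capVals_bddAbove {d d₁ d₂ : Type} [Fintype d] [Fintype d₁] [Fintype d₂]
    [DecidableEq d] [DecidableEq d₁] [DecidableEq d₂] {W : Matrix (d₁ × d₂) d ℂ}
    (hW : Wᴴ * W = 1) {T : Mat d → Mat d₂} (hT : ∀ σ, T σ = ptrace₁ (W * σ * Wᴴ)) :
    BddAbove (capVals T) := by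
  refine ⟨Fintype.card d₂, ?_⟩
  rintro x ⟨m, p, v, hp, -, hv, rfl⟩
  have hst : ∀ i, IsState (T (pureState (v i))) := by
    intro i
    have := (hv i).isState.isometry_conj hW
    rw [hT]
    exact ⟨posSemidef_ptrace₁ this.1, by rw [trace_ptrace₁, this.2]⟩
  have h1 : entropy (∑ i, (p i : ℂ) • T (pureState (v i))) ≤ Fintype.card d₂ :=
    entropy_le_card <| posSemidef_sum _ fun i _ =>
      (hst i).1.smul (by exact_mod_cast hp i)
  have h2 : 0 ≤ ∑ i, p i * entropy (T (pureState (v i))) :=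
    Finset.sum_nonneg fun i _ => mul_nonneg (hp i) (hst i).entropy_nonneg
  linarith

/-- One half of the formula for the capacity in terms of the entanglement of formation:
every state on the range of the Stinespring isometry gives a lower bound. -/
theorem entropy_sub_Ef_le_holevoCap {d d₁ d₂ : Type} [Fintype d] [Fintype d₁] [Fintype d₂]
    [DecidableEq d] [DecidableEq d₁] [DecidableEq d₂] {W : Matrix (d₁ × d₂) d ℂ}
    (hW : Wᴴ * W = 1) {T : Mat d → Mat d₂} (hT : ∀ σ, T σ = ptrace₁ (W * σ * Wᴴ))
    {τ : Mat d} (hτ : IsState τ) :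
    entropy (ptrace₁ (W * τ * Wᴴ)) - Ef (W * τ * Wᴴ) ≤ holevoCap T := by
  have hst := hτ.isometry_conj hW
  rw [sub_le_comm]
  refine le_csInf (efVals_nonempty hst.1) ?_
  rintro x ⟨m, p, v, hp, hv, hdec, rfl⟩
  rw [sub_le_comm]
  have hp1 : ∑ i, p i = 1 := by
    have := sum_eq_trace_of_pureState_decomposition (p := p) hv
    rw [← hdec, hst.2] at this
    exact_mod_cast this.symm
  have hrange : ∀ i, p i ≠ 0 → W *ᵥ (Wᴴ *ᵥ v i) = v i := fun i hi =>
    mulVec_conjTranspose_mulVec_of_decomposition hW τ hp hdec hi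
  have hunit : ∀ i, p i ≠ 0 → UnitVec (Wᴴ *ᵥ v i) := by
    intro i hi
    rw [unitVec_iff_trace_pureState, ← trace_isometry_conj hW, pureState_mulVec, hrange i hi]
    exact (hv i).isState.2
  obtain ⟨i₀, hi₀⟩ : ∃ i, p i ≠ 0 := by
    by_contra! hz
    simp [hz] at hp1
  let u : Fin m → d → ℂ := fun i => if p i = 0 then Wᴴ *ᵥ v i₀ else Wᴴ *ᵥ v i
  have hu : ∀ i, UnitVec (u i) := by
    intro i
    by_cases hi : p i = 0
    · simpa [u, hi] using hunit i₀ hi₀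
    · simpa [u, hi] using hunit i hi
  have hTu : ∀ i, p i ≠ 0 → T (pureState (u i)) = ptrace₁ (pureState (v i)) := by
    intro i hi
    rw [hT, pureState_mulVec]
    simp [u, hi, hrange i hi]
  refine le_csSup (capVals_bddAbove hW hT) ⟨m, p, u, hp, hp1, hu, ?_⟩
  congr 1
  · rw [hdec, ptrace₁_sum_smul]
    congr 1
    refine Finset.sum_congr rfl fun i _ => ?_
    by_cases hi : p i = 0
    · simp [hi]
    · rw [hTu i hi]
  · refine Finset.sum_congr rfl fun i _ => ?_
    by_cases hi : p i = 0
    · simp [hi]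
    · rw [hTu i hi, entropy_ptrace₁_pureState]

theorem pairProd_eq_reindex {d₁ d₂ d₁' d₂' : Type} [Fintype d₁] [Fintype d₂] [Fintype d₁']
    [Fintype d₂'] (ρ : Mat (d₁ × d₂)) (ρ' : Mat (d₁' × d₂')) :
    pairProd ρ ρ' = reindex (Equiv.prodProdProdComm d₁ d₂ d₁' d₂')
      (Equiv.prodProdProdComm d₁ d₂ d₁' d₂') (ρ ⊗ₖ ρ') := by
  ext a b
  simp [pairProd, kroneckerMap_apply]

theorem stmt5
    {d d₁ d₂ d' d₁' d₂' : Type}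
    [Fintype d] [Fintype d₁] [Fintype d₂] [Fintype d'] [Fintype d₁'] [Fintype d₂']
    [DecidableEq d] [DecidableEq d₁] [DecidableEq d₂]
    [DecidableEq d'] [DecidableEq d₁'] [DecidableEq d₂']
    (U : Matrix (d₁ × d₂) d ℂ) (hU : Uᴴ * U = 1)
    (U' : Matrix (d₁' × d₂') d' ℂ) (hU' : U'ᴴ * U' = 1)
    (T : Mat d → Mat d₂) (hT : ∀ σ : Mat d, T σ = ptrace₁ (U * σ * Uᴴ))
    (T' : Mat d' → Mat d₂') (hT' : ∀ σ : Mat d', T' σ = ptrace₁ (U' * σ * U'ᴴ))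
    (W : Matrix ((d₁ × d₁') × (d₂ × d₂')) (d × d') ℂ)
    (hW : W = (Matrix.reindex (Equiv.prodProdProdComm d₁ d₂ d₁' d₂')
        (Equiv.refl (d × d'))) (U ⊗ₖ U'))
    (T₂ : Mat (d × d') → Mat (d₂ × d₂'))
    (hT₂ : ∀ σ : Mat (d × d'), T₂ σ = ptrace₁ (W * σ * Wᴴ))
    (hadd : holevoCap T₂ = holevoCap T + holevoCap T')
    (ρ : Mat (d₁ × d₂)) (ρ' : Mat (d₁' × d₂'))
    (hρK : ∃ σ : Mat d, IsState σ ∧ ρ = U * σ * Uᴴ)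
    (hρ'K : ∃ σ' : Mat d', IsState σ' ∧ ρ' = U' * σ' * U'ᴴ)
    (hopt : holevoCap T = entropy (ptrace₁ ρ) - Ef ρ)
    (hopt' : holevoCap T' = entropy (ptrace₁ ρ') - Ef ρ') :
    Ef (pairProd ρ ρ') = Ef ρ + Ef ρ' := by
  obtain ⟨σ, hσ, rfl⟩ := hρK
  obtain ⟨σ', hσ', rfl⟩ := hρ'K
  have hρ := hσ.isometry_conj hU
  have hρ' := hσ'.isometry_conj hU'
  have hWW : Wᴴ * W = 1 := by
    rw [hW, conjTranspose_reindex, reindex_apply, reindex_apply, submatrix_mul_equiv,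
      conjTranspose_kronecker, ← mul_kronecker_mul, hU, hU', one_kronecker_one]
    simp
  have hpair : pairProd (U * σ * Uᴴ) (U' * σ' * U'ᴴ) = W * (σ ⊗ₖ σ') * Wᴴ := by
    rw [pairProd_eq_reindex, mul_kronecker_mul, mul_kronecker_mul, ← conjTranspose_kronecker,
      hW, conjTranspose_reindex]
    rfl
  have hτ : IsState (σ ⊗ₖ σ') :=
    ⟨hσ.1.kronecker hσ'.1, by rw [trace_kronecker, hσ.2, hσ'.2, one_mul]⟩
  refine le_antisymm (Ef_pairProd_le hρ hρ') ?_
  have hcap := entropy_sub_Ef_le_holevoCap hWW hT₂ hτ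
  rw [← hpair, ptrace₁_pairProd, entropy_kronecker (posSemidef_ptrace₁ hρ.1).1
    (posSemidef_ptrace₁ hρ'.1).1 (by rw [trace_ptrace₁, hρ.2])
    (by rw [trace_ptrace₁, hρ'.2])] at hcap
  linarith
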